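/- Under the stated hypotheses on Φ and f, one has the chain of vanishings at the origin: Y1_{x1}(0) = 0, Y2_{x1}(0) = 0, Y2_{x2}(0) = 0, and consequently Y3_{x3}(0) = 0 and Y3_{y3}(0) = 1. -/

import Mathlib

noncomputable section

/-- The model space `ℝ^13` with coordinates
`(t, x0, y0, x1, y1, x2, y2, x3, y3, x4, y4, x5, y5)`
indexed by `0, 1, ..., 12` respectively. -/
abbrev E13 := Fin 13 → ℝ

/-- The constant coordinate vector field `∂_u` of the `i`-th coordinate. -/
def e (i : Fin 13) : E13 := Pi.single i 1

/-- Partial derivative of a scalar function `F` in the `i`-th coordinate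
direction, at a point `p`. -/
def pd (F : E13 → ℝ) (i : Fin 13) (p : E13) : ℝ := fderiv ℝ F p (e i)

/-- The vector field `Z''_{1,a}` of the EKR pseudo-normal form for the
singularity class 1.2.1.2.1 (at tangency points with the locus of 1.2.1.2):
`Z''_{1,a} = ∂_{x3} + (1 + y4)·∂_{y3} + x5·∂_{x4} + (a + y5)·∂_{y4}
 + x4·( ∂_{x1} + y2·∂_{y1} + (1 + x3)·∂_{x2} + y3·∂_{y2} + x2·( ∂_t + x1·∂_{x0} + y1·∂_{y0} ) )`. -/
def Z (a : ℝ) (p : E13) : E13 :=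
  e 7 + (1 + p 10) • e 8 + p 11 • e 9 + (a + p 12) • e 10 +
    p 9 • (e 3 + p 6 • e 4 + (1 + p 7) • e 5 + p 8 • e 6 +
      p 5 • (e 0 + p 3 • e 1 + p 4 • e 2))

theorem e_apply (i j : Fin 13) : e i j = if j = i then 1 else 0 := by
  simp [e, Pi.single_apply]

/-- `F` depends only on the coordinates of index at most `m`. -/
def DependsUpTo (F : E13 → ℝ) (m : ℕ) : Prop :=
  ∀ p q : E13, (∀ k : Fin 13, (k : ℕ) ≤ m → p k = q k) → F p = F q

theorem pd_eq_of_eventuallyEq_line {F : E13 → ℝ} {k : Fin 13} {s φ' : ℝ} {φ : ℝ → ℝ}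
    (hF : DifferentiableAt ℝ F (s • e k)) (hφ : HasDerivAt φ φ' s)
    (h : ∀ᶠ x in nhds s, F (x • e k) = φ x) : pd F k (s • e k) = φ' := by
  have hline : HasDerivAt (fun x : ℝ => x • e k) (e k) s := by
    simpa using (hasDerivAt_id s).smul_const (e k)
  exact (hF.hasFDerivAt.comp_hasDerivAt s hline).unique (hφ.congr_of_eventuallyEq h)

theorem DependsUpTo.pd_eq_zero {F : E13 → ℝ} {m : ℕ} (h : DependsUpTo F m) {p : E13}
    (hF : DifferentiableAt ℝ F p) {k : Fin 13} (hk : m < k) : pd F k p = 0 := by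
  have hconst : (fun s : ℝ => F (p + s • e k)) = fun _ => F p := by
    funext s
    refine h _ _ fun j hj => ?_
    have hjk : j ≠ k := by rintro rfl; omega
    simp [e_apply, hjk]
  rw [pd, ← hF.lineDeriv_eq_fderiv, lineDeriv, hconst, deriv_const]

theorem DependsUpTo.pd_congr {F : E13 → ℝ} {m : ℕ} (h : DependsUpTo F m) {p q : E13}
    (hpq : ∀ k : Fin 13, (k : ℕ) ≤ m → p k = q k) (k : Fin 13) : pd F k p = pd F k q := by
  have htrans : (fun x => F (x + (p - q))) = F := by
    funext x
    refine h _ _ fun j hj => ?_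
    simp [hpq j hj]
  have hfd := fderiv_comp_add_right (𝕜 := ℝ) (f := F) (x := q) (p - q)
  rw [htrans, add_sub_cancel] at hfd
  rw [pd, pd, hfd]

theorem fderiv_Z_apply {Φ : E13 → E13} {p : E13} (hΦ : DifferentiableAt ℝ Φ p) (c : ℝ)
    (i : Fin 13) :
    fderiv ℝ Φ p (Z c p) i =
      pd (fun x => Φ x i) 7 p + (1 + p 10) * pd (fun x => Φ x i) 8 p +
        p 11 * pd (fun x => Φ x i) 9 p + (c + p 12) * pd (fun x => Φ x i) 10 p +
        p 9 * (pd (fun x => Φ x i) 3 p + p 6 * pd (fun x => Φ x i) 4 p +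
          (1 + p 7) * pd (fun x => Φ x i) 5 p + p 8 * pd (fun x => Φ x i) 6 p +
          p 5 * (pd (fun x => Φ x i) 0 p + p 3 * pd (fun x => Φ x i) 1 p +
            p 4 * pd (fun x => Φ x i) 2 p)) := by
  have hpd : ∀ k, pd (fun x => Φ x i) k p = fderiv ℝ Φ p (e k) i := fun k => by
    rw [pd, (hasFDerivAt_pi'.1 hΦ.hasFDerivAt i).fderiv]
    rfl
  simp only [hpd, Z, map_add, map_smul, Pi.add_apply, Pi.smul_apply, smul_eq_mul]

theorem apply_eq_zero_of_mem_span {v : E13} (hv : v ∈ Submodule.span ℝ ({e 11, e 12} : Set E13))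
    {i : Fin 13} (hi : (i : ℕ) ≤ 10) : v i = 0 := by
  obtain ⟨a, b, rfl⟩ := Submodule.mem_span_pair.1 hv
  have h11 : i ≠ 11 := by rintro rfl; simp at hi
  have h12 : i ≠ 12 := by rintro rfl; simp at hi
  simp [e_apply, h11, h12]

/-- `Y1_{x1}(0) = 0`, `Y2_{x1}(0) = 0`, `Y2_{x2}(0) = 0`, and consequently `Y3_{x3}(0) = 0` and `Y3_{y3}(0) = 1`. -/
theorem chain_of_vanishings_12121 (c c' : ℝ)
    (Φ : E13 → E13) (U : Set E13) (hU : IsOpen U) (h0U : (0 : E13) ∈ U)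
    (hΦsmooth : ContDiffOn ℝ (⊤ : ℕ∞) Φ U) (hΦ0 : Φ 0 = 0)
    (hdiffeo : Function.Bijective (fderiv ℝ Φ 0))
    -- the components `T, X0, Y0` (indices 0,1,2) depend only on `t, x0, y0`
    (htri0 : ∀ p q : E13, (∀ k : Fin 13, (k : ℕ) ≤ 2 → p k = q k) →
      ∀ i : Fin 13, (i : ℕ) ≤ 2 → Φ p i = Φ q i)
    -- for `1 ≤ j ≤ 5`, the components `Xj, Yj` (indices 2j+1, 2j+2)
    -- depend only on `t, x0, y0, x1, y1, ..., xj, yj`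
    (htri : ∀ j : ℕ, 1 ≤ j → j ≤ 5 → ∀ p q : E13,
      (∀ k : Fin 13, (k : ℕ) ≤ 2 * j + 2 → p k = q k) →
      ∀ i : Fin 13, ((i : ℕ) = 2 * j + 1 ∨ (i : ℕ) = 2 * j + 2) → Φ p i = Φ q i)
    (H G : E13 → ℝ)
    (hHs : ContDiffOn ℝ (⊤ : ℕ∞) H U) (hGs : ContDiffOn ℝ (⊤ : ℕ∞) G U)
    (hH0 : H 0 ≠ 0) (hG0 : G 0 ≠ 0)
    -- `X2 = x2·H`, `X4 = x4·G`
    (hX2 : ∀ p ∈ U, Φ p 5 = p 5 * H p)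
    (hX4 : ∀ p ∈ U, Φ p 9 = p 9 * G p)
    (f : E13 → ℝ) (hfs : ContDiffOn ℝ (⊤ : ℕ∞) f U) (hf0 : f 0 ≠ 0)
    -- `dΦ(p)·Z_{1,c}(p) − f(p)·Z_{1,c'}(Φ(p)) ∈ span{∂_{x5}, ∂_{y5}}` near 0
    (hconj : ∀ p ∈ U, fderiv ℝ Φ p (Z c p) - f p • Z c' (Φ p) ∈
      Submodule.span ℝ ({e 11, e 12} : Set E13)) :
    pd (fun p => Φ p 4) 3 0 = 0 ∧ pd (fun p => Φ p 6) 3 0 = 0 ∧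
      pd (fun p => Φ p 6) 5 0 = 0 ∧ pd (fun p => Φ p 8) 7 0 = 0 ∧
      pd (fun p => Φ p 8) 8 0 = 1 := by
  have hdΦ : ∀ p ∈ U, DifferentiableAt ℝ Φ p := fun p hp =>
    (hΦsmooth.contDiffAt (hU.mem_nhds hp)).differentiableAt (by simp)
  have hdiff : ∀ p ∈ U, ∀ i, DifferentiableAt ℝ (fun x => Φ x i) p := fun p hp i =>
    differentiableAt_pi.1 (hdΦ p hp) i
  have hΦ0i : ∀ i, Φ 0 i = 0 := fun i => by simp [hΦ0]
  have dep0 : ∀ i : Fin 13, (i : ℕ) ≤ 2 → DependsUpTo (fun x => Φ x i) 2 :=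
    fun i hi p q h => htri0 p q h i hi
  have depT := dep0 0 (by simp)
  have depY0 := dep0 2 (by simp)
  have depX1 : DependsUpTo (fun x => Φ x 3) 4 :=
    fun p q h => htri 1 (by simp) (by simp) p q h 3 (by simp)
  have depY1 : DependsUpTo (fun x => Φ x 4) 4 :=
    fun p q h => htri 1 (by simp) (by simp) p q h 4 (by simp)
  have depX2 : DependsUpTo (fun x => Φ x 5) 6 :=
    fun p q h => htri 2 (by simp) (by simp) p q h 5 (by simp)
  have depY2 : DependsUpTo (fun x => Φ x 6) 6 :=
    fun p q h => htri 2 (by simp) (by simp) p q h 6 (by simp)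
  have depX3 : DependsUpTo (fun x => Φ x 7) 8 :=
    fun p q h => htri 3 (by simp) (by simp) p q h 7 (by simp)
  have depY3 : DependsUpTo (fun x => Φ x 8) 8 :=
    fun p q h => htri 3 (by simp) (by simp) p q h 8 (by simp)
  have hcomp : ∀ p ∈ U, ∀ i : Fin 13, (i : ℕ) ≤ 10 →
      fderiv ℝ Φ p (Z c p) i = f p * Z c' (Φ p) i := fun p hp i hi => by
    have h := apply_eq_zero_of_mem_span (hconj p hp) hi
    simpa [sub_eq_zero] using h
  -- a cube around the origin on which `f`, `G` and `H` do not vanish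
  obtain ⟨r, hr, hball⟩ : ∃ r > 0, ∀ p : E13, (∀ k, |p k| < r) →
      p ∈ U ∧ f p ≠ 0 ∧ G p ≠ 0 ∧ H p ≠ 0 := by
    have hnhds := hU.mem_nhds h0U
    have hev : ∀ᶠ p in nhds (0 : E13), p ∈ U ∧ f p ≠ 0 ∧ G p ≠ 0 ∧ H p ≠ 0 :=
      (Filter.eventually_mem_set.2 hnhds).and <|
        ((hfs.continuousOn.continuousAt hnhds).eventually_ne hf0).and <|
        ((hGs.continuousOn.continuousAt hnhds).eventually_ne hG0).and
        ((hHs.continuousOn.continuousAt hnhds).eventually_ne hH0)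
    obtain ⟨r, hr, h⟩ := Metric.eventually_nhds_iff.1 hev
    refine ⟨r, hr, fun p hp => h ?_⟩
    rw [dist_zero_right, pi_norm_lt_iff hr]
    exact hp
  obtain ⟨v, hv0, hvr⟩ : ∃ v : ℝ, v ≠ 0 ∧ |v| < r :=
    ⟨r / 2, by positivity, by rw [abs_of_pos (by positivity)]; linarith⟩
  have hnear : ∀ᶠ s in nhds (0 : ℝ), |s| < r :=
    (continuous_abs.tendsto 0).eventually_lt_const (by simpa using hr)
  -- the equations for `X1, Y1, X2, Y2`, divided by `x4`
  have eqX1 : ∀ p ∈ U, p 9 ≠ 0 → pd (fun x => Φ x 3) 3 p + p 6 * pd (fun x => Φ x 3) 4 p +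
      p 5 * (pd (fun x => Φ x 3) 0 p + p 3 * pd (fun x => Φ x 3) 1 p +
        p 4 * pd (fun x => Φ x 3) 2 p) = f p * G p := fun p hp h9 => by
    have h := hcomp p hp 3 (by simp)
    rw [fderiv_Z_apply (hdΦ p hp)] at h
    simp [depX1.pd_eq_zero (hdiff p hp 3), Z, e_apply, hX4 p hp] at h
    exact mul_left_cancel₀ h9 (by linear_combination h)
  have eqY1 : ∀ p ∈ U, p 9 ≠ 0 → pd (fun x => Φ x 4) 3 p + p 6 * pd (fun x => Φ x 4) 4 p +
      p 5 * (pd (fun x => Φ x 4) 0 p + p 3 * pd (fun x => Φ x 4) 1 p +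
        p 4 * pd (fun x => Φ x 4) 2 p) = f p * G p * Φ p 6 := fun p hp h9 => by
    have h := hcomp p hp 4 (by simp)
    rw [fderiv_Z_apply (hdΦ p hp)] at h
    simp [depY1.pd_eq_zero (hdiff p hp 4), Z, e_apply, hX4 p hp] at h
    exact mul_left_cancel₀ h9 (by linear_combination h)
  have eqX2 : ∀ p ∈ U, p 9 ≠ 0 → pd (fun x => Φ x 5) 3 p + p 6 * pd (fun x => Φ x 5) 4 p +
      (1 + p 7) * pd (fun x => Φ x 5) 5 p + p 8 * pd (fun x => Φ x 5) 6 p +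
      p 5 * (pd (fun x => Φ x 5) 0 p + p 3 * pd (fun x => Φ x 5) 1 p +
        p 4 * pd (fun x => Φ x 5) 2 p) = f p * G p * (1 + Φ p 7) := fun p hp h9 => by
    have h := hcomp p hp 5 (by simp)
    rw [fderiv_Z_apply (hdΦ p hp)] at h
    simp [depX2.pd_eq_zero (hdiff p hp 5), Z, e_apply, hX4 p hp] at h
    exact mul_left_cancel₀ h9 (by linear_combination h)
  have eqY2 : ∀ p ∈ U, p 9 ≠ 0 → pd (fun x => Φ x 6) 3 p + p 6 * pd (fun x => Φ x 6) 4 p +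
      (1 + p 7) * pd (fun x => Φ x 6) 5 p + p 8 * pd (fun x => Φ x 6) 6 p +
      p 5 * (pd (fun x => Φ x 6) 0 p + p 3 * pd (fun x => Φ x 6) 1 p +
        p 4 * pd (fun x => Φ x 6) 2 p) = f p * G p * Φ p 8 := fun p hp h9 => by
    have h := hcomp p hp 6 (by simp)
    rw [fderiv_Z_apply (hdΦ p hp)] at h
    simp [depY2.pd_eq_zero (hdiff p hp 6), Z, e_apply, hX4 p hp] at h
    exact mul_left_cancel₀ h9 (by linear_combination h)
  -- the equations for `T, Y0`, divided by `x2 * x4`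
  have eqT : ∀ p ∈ U, p 9 ≠ 0 → p 5 ≠ 0 → pd (fun x => Φ x 0) 0 p +
      p 3 * pd (fun x => Φ x 0) 1 p + p 4 * pd (fun x => Φ x 0) 2 p =
        f p * G p * H p := fun p hp h9 h5 => by
    have h := hcomp p hp 0 (by simp)
    rw [fderiv_Z_apply (hdΦ p hp)] at h
    simp [depT.pd_eq_zero (hdiff p hp 0), Z, e_apply, hX4 p hp, hX2 p hp] at h
    exact mul_left_cancel₀ (mul_ne_zero h9 h5) (by linear_combination h)
  have eqY0 : ∀ p ∈ U, p 9 ≠ 0 → p 5 ≠ 0 → pd (fun x => Φ x 2) 0 p +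
      p 3 * pd (fun x => Φ x 2) 1 p + p 4 * pd (fun x => Φ x 2) 2 p =
        f p * G p * H p * Φ p 4 := fun p hp h9 h5 => by
    have h := hcomp p hp 2 (by simp)
    rw [fderiv_Z_apply (hdΦ p hp)] at h
    simp [depY0.pd_eq_zero (hdiff p hp 2), Z, e_apply, hX4 p hp, hX2 p hp] at h
    exact mul_left_cancel₀ (mul_ne_zero h9 h5) (by linear_combination h)
  have cube : ∀ (s : ℝ) (i : Fin 13), |s| < r → ∀ k, |(s • e i) k| < r := fun s i hs k => by
    by_cases hk : k = i <;> simp [e_apply, hk, hs, hr]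
  have pd_line0 : ∀ (i k : Fin 13) (φ : ℝ → ℝ) (φ' : ℝ), HasDerivAt φ φ' 0 →
      (∀ s, |s| < r → Φ (s • e k) i = φ s) → pd (fun x => Φ x i) k 0 = φ' :=
    fun i k φ φ' hφ h => by
      have hz : (0 : ℝ) • e k = 0 := zero_smul _ _
      rw [← hz]
      exact pd_eq_of_eventuallyEq_line (by rw [hz]; exact hdiff 0 h0U i) hφ
        (hnear.mono h)
  -- `Y1_{x1}(0) = 0`
  have hY1x1 : pd (fun x => Φ x 4) 3 0 = 0 := by
    have hp := (hball (v • e 9) (cube v 9 hvr)).1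
    have h := eqY1 _ hp (by simpa [e_apply] using hv0)
    rw [depY1.pd_congr (q := 0) (by intro k hk; fin_cases k <;> simp [e_apply] at hk ⊢),
      show Φ (v • e 9) 6 = 0 from
        (depY2 _ 0 (by intro k hk; fin_cases k <;> simp [e_apply] at hk ⊢)).trans (hΦ0i 6)] at h
    simpa [e_apply] using h
  -- `Y1` vanishes along the `x1`-axis
  have hY1 : ∀ s, |s| < r → Φ (s • e 3) 4 = 0 := by
    set a := pd (fun x => Φ x 0) 0 0
    set b := pd (fun x => Φ x 0) 1 0
    set a' := pd (fun x => Φ x 2) 0 0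
    set b' := pd (fun x => Φ x 2) 1 0
    have key : ∀ s, |s| < r → a + s * b ≠ 0 ∧ a' + s * b' = (a + s * b) * Φ (s • e 3) 4 := by
      intro s hs
      obtain ⟨hp, hf, hG, hH⟩ := hball (s • e 3 + v • e 5 + v • e 9) (by
        intro k; fin_cases k <;> simp [e_apply, hs, hvr, hr])
      have hT := eqT _ hp (by simpa [e_apply] using hv0) (by simpa [e_apply] using hv0)
      have hY := eqY0 _ hp (by simpa [e_apply] using hv0) (by simpa [e_apply] using hv0)
      have hlow : ∀ k : Fin 13, (k : ℕ) ≤ 2 →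
          (s • e 3 + v • e 5 + v • e 9) k = (0 : E13) k := by
        intro k hk; fin_cases k <;> simp [e_apply] at hk ⊢
      have h4 : Φ (s • e 3 + v • e 5 + v • e 9) 4 = Φ (s • e 3) 4 := depY1 _ _ (by
        intro k hk; fin_cases k <;> simp [e_apply] at hk ⊢)
      simp only [depT.pd_congr hlow] at hT
      simp only [depY0.pd_congr hlow, h4, ← hT] at hY
      have hne := mul_ne_zero (mul_ne_zero hf hG) hH
      rw [← hT] at hne
      simp [e_apply] at hne hY
      exact ⟨hne, hY⟩
    have h0 := key 0 (by simpa using hr)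
    have ha' : a' = 0 := by simpa [hΦ0i] using h0.2
    have ha : a ≠ 0 := by simpa using h0.1
    have hb' : b' / a = 0 := by
      rw [← hY1x1]
      refine (pd_line0 4 3 (fun s => s * b' / (a + s * b)) _ ?_ fun s hs => ?_).symm
      · have hnum : HasDerivAt (fun s : ℝ => s * b') b' 0 := by
          simpa using (hasDerivAt_id (0 : ℝ)).mul_const b'
        have hden : HasDerivAt (fun s : ℝ => a + s * b) b 0 := by
          simpa using ((hasDerivAt_id (0 : ℝ)).mul_const b).const_add a
        have hval : b' / a = (b' * (a + 0 * b) - 0 * b' * b) / (a + 0 * b) ^ 2 := by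
          simp only [zero_mul, add_zero, sub_zero]
          field_simp
        rw [hval]
        exact hnum.div hden h0.1
      · obtain ⟨hne, h⟩ := key s hs
        rw [eq_div_iff hne]
        linear_combination -h + ha'
    have hb'0 : b' = 0 := (div_eq_zero_iff.1 hb').resolve_right ha
    intro s hs
    obtain ⟨hne, h⟩ := key s hs
    simpa [ha', hb'0, hne] using h
  -- `Y2` vanishes along the `x1`-axis
  have hY2x1 : pd (fun x => Φ x 6) 3 0 = 0 := by
    refine pd_line0 6 3 (fun _ => 0) 0 (hasDerivAt_const _ _) fun s hs => ?_
    have hzero : pd (fun x => Φ x 4) 3 (s • e 3) = 0 :=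
      pd_eq_of_eventuallyEq_line (hdiff _ (hball _ (cube s 3 hs)).1 4) (hasDerivAt_const s 0)
        (((continuous_abs.tendsto s).eventually_lt_const hs).mono hY1)
    obtain ⟨hp, hf, hG, -⟩ := hball (s • e 3 + v • e 9) (by
      intro k; fin_cases k <;> simp [e_apply, hs, hvr, hr])
    have h := eqY1 _ hp (by simpa [e_apply] using hv0)
    rw [depY1.pd_congr (q := s • e 3)
        (by intro k hk; fin_cases k <;> simp [e_apply] at hk ⊢), hzero,
      show Φ (s • e 3 + v • e 9) 6 = Φ (s • e 3) 6 from
        depY2 _ _ (by intro k hk; fin_cases k <;> simp [e_apply] at hk ⊢)] at h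
    simpa [e_apply, hf, hG] using h
  -- `Y2` and `X2` along the `(x3, y3)`-plane
  have plane : ∀ s w, |s| < r → |w| < r →
      pd (fun x => Φ x 3) 3 0 ≠ 0 ∧
      (1 + s) * pd (fun x => Φ x 6) 5 0 + w * pd (fun x => Φ x 6) 6 0 =
        pd (fun x => Φ x 3) 3 0 * Φ (s • e 7 + w • e 8) 8 ∧
      pd (fun x => Φ x 5) 3 0 + (1 + s) * pd (fun x => Φ x 5) 5 0 +
          w * pd (fun x => Φ x 5) 6 0 =
        pd (fun x => Φ x 3) 3 0 * (1 + Φ (s • e 7 + w • e 8) 7) := by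
    intro s w hs hw
    obtain ⟨hp, hf, hG, -⟩ := hball (s • e 7 + w • e 8 + v • e 9) (by
      intro k; fin_cases k <;> simp [e_apply, hs, hw, hvr, hr])
    have h9 : (s • e 7 + w • e 8 + v • e 9) 9 ≠ 0 := by simpa [e_apply] using hv0
    have hlow : ∀ k : Fin 13, (k : ℕ) ≤ 6 →
        (s • e 7 + w • e 8 + v • e 9) k = (0 : E13) k := by
      intro k hk; fin_cases k <;> simp [e_apply] at hk ⊢
    have hX1 := eqX1 _ hp h9
    have hX2 := eqX2 _ hp h9
    have hY2 := eqY2 _ hp h9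
    have hmid : ∀ k : Fin 13, (k : ℕ) ≤ 8 →
        (s • e 7 + w • e 8 + v • e 9) k = (s • e 7 + w • e 8) k := by
      intro k hk; fin_cases k <;> simp [e_apply] at hk ⊢
    have h7 : Φ (s • e 7 + w • e 8 + v • e 9) 7 = Φ (s • e 7 + w • e 8) 7 := depX3 _ _ hmid
    have h8 : Φ (s • e 7 + w • e 8 + v • e 9) 8 = Φ (s • e 7 + w • e 8) 8 := depY3 _ _ hmid
    simp only [depX1.pd_congr fun k hk => hlow k (by omega)] at hX1
    simp only [depX2.pd_congr hlow, h7, ← hX1] at hX2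
    simp only [depY2.pd_congr hlow, h8, ← hX1] at hY2
    have hne := mul_ne_zero hf hG
    rw [← hX1] at hne
    simp [e_apply, hY2x1] at hne hX2 hY2
    exact ⟨hne, hY2, hX2⟩
  have hr0 : |(0 : ℝ)| < r := by simpa using hr
  obtain ⟨hX1x1, hY2at0, hX2at0⟩ := plane 0 0 hr0 hr0
  have hY2x2 : pd (fun x => Φ x 6) 5 0 = 0 := by simpa [hΦ0i] using hY2at0
  have hY3x3 : pd (fun x => Φ x 8) 7 0 = 0 := by
    refine pd_line0 8 7 (fun _ => 0) 0 (hasDerivAt_const _ _) fun s hs => ?_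
    simpa [hY2x2, hX1x1] using (plane s 0 hs hr0).2.1
  have hX2axis : ∀ k : Fin 13, k ≠ 5 → pd (fun x => Φ x 5) k 0 = 0 := fun k hk => by
    refine pd_line0 5 k (fun _ => 0) 0 (hasDerivAt_const _ _) fun s hs => ?_
    rw [hX2 _ (hball _ (cube s k hs)).1]
    simp [e_apply, hk.symm]
  simp only [hX2axis 3 (by decide), hX2axis 6 (by decide)] at plane hX2at0
  have hX2x2 : pd (fun x => Φ x 5) 5 0 = pd (fun x => Φ x 3) 3 0 := by
    simpa [hΦ0i] using hX2at0
  have hX3 : ∀ s w, |s| < r → |w| < r → Φ (s • e 7 + w • e 8) 7 = s := fun s w hs hw => by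
    obtain ⟨hne, -, h⟩ := plane s w hs hw
    rw [hX2x2] at h
    exact mul_left_cancel₀ hne (by linear_combination -h)
  have hX3x3 : pd (fun x => Φ x 7) 7 0 = 1 :=
    pd_line0 7 7 id 1 (hasDerivAt_id _) fun s hs => by simpa using hX3 s 0 hs hr0
  have hX3y3 : pd (fun x => Φ x 7) 8 0 = 0 :=
    pd_line0 7 8 (fun _ => 0) 0 (hasDerivAt_const _ _) fun s hs => by
      simpa using hX3 0 s hr0 hs
  have hf7 := hcomp 0 h0U 7 (by simp)
  have hf8 := hcomp 0 h0U 8 (by simp)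
  rw [fderiv_Z_apply (hdΦ 0 h0U)] at hf7 hf8
  simp [depX3.pd_eq_zero (hdiff 0 h0U 7), Z, e_apply, hΦ0i, hX3x3, hX3y3] at hf7
  simp [depY3.pd_eq_zero (hdiff 0 h0U 8), Z, e_apply, hΦ0i, hY3x3] at hf8
  exact ⟨hY1x1, hY2x1, hY2x2, hY3x3, hf8.trans hf7.symm⟩
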